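/- arXiv:1311.0855 — 11 statements merged into one kernel-verified Lean document; each statement's English description precedes it below -/
import Mathlib

section
/- Let δ ≥ 0 and let X be a δ-hyperbolic metric space. Then for all points x, y, z, s, t of X: (1) (x,y)_t ≤ max{ d(x,t) − (y,z)_x , (x,z)_t } + δ; (2) d(s,t) ≤ |d(x,s) − d(x,t)| + 2·max{ (x,y)_s , (x,y)_t } + 2δ; (3) d(s,t) ≤ max{ |d(x,s) − d(x,t)| + 2·max{ (x,y)_s , (x,z)_t } , d(x,s) + d(x,t) − 2(y,z)_x } + 4δ. -/
/-- The Gromov product `(y,z)_x = (d(x,y) + d(x,z) - d(y,z)) / 2`. -/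
noncomputable def gprod {X : Type*} [MetricSpace X] (x y z : X) : ℝ :=
  (dist x y + dist x z - dist y z) / 2

/-- A metric space is `δ`-hyperbolic if `(x,z)_t ≥ min ((x,y)_t) ((y,z)_t) - δ`
for all `x y z t`. -/
def DeltaHyp (X : Type*) [MetricSpace X] (δ : ℝ) : Prop :=
  ∀ x y z t : X, gprod t x z ≥ min (gprod t x y) (gprod t y z) - δ

theorem metric_inequalities {X : Type*} [MetricSpace X] {δ : ℝ} (hδ : 0 ≤ δ)
    (hhyp : DeltaHyp X δ) (x y z s t : X) :
    gprod t x y ≤ max (dist x t - gprod x y z) (gprod t x z) + δ ∧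
    dist s t ≤ |dist x s - dist x t| + 2 * max (gprod s x y) (gprod t x y) + 2 * δ ∧
    dist s t ≤ max (|dist x s - dist x t| + 2 * max (gprod s x y) (gprod t x z))
        (dist x s + dist x t - 2 * gprod x y z) + 4 * δ := by
  have h₁ := hhyp s y t x
  have h₂ := hhyp t z y x
  have habs := le_abs_self (dist x s - dist x t)
  have habs' := neg_abs_le (dist x s - dist x t)
  simp only [gprod, ge_iff_le, sub_le_iff_le_add, min_le_iff] at h₁ h₂ ⊢
  simp only [dist_comm s x, dist_comm t x, dist_comm t y, dist_comm t z,
    dist_comm s y, dist_comm z y] at h₁ h₂ ⊢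
  refine ⟨?_, ?_, ?_⟩ <;> grind
end

section
/- Let δ > 0 and let X be a δ-hyperbolic length space. Let x ∈ X and let (zₙ) be a sequence in X converging to infinity. Then for every l ≥ 0 and every η > 0 there exist a point y ∈ X with d(x,y) = l and an integer N such that (x, zₙ)_y ≤ δ + η for every n ≥ N. -/
/-- A length space: any two points are joined by a rectifiable path (here
parametrized by arclength, hence `1`-Lipschitz) of length at most `d(x,y) + ε`. -/
def IsLengthSpace (X : Type*) [MetricSpace X] : Prop :=
  ∀ x y : X, ∀ ε : ℝ, 0 < ε → ∃ L : ℝ, 0 ≤ L ∧ L ≤ dist x y + ε ∧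
    ∃ γ : ℝ → X, γ 0 = x ∧ γ L = y ∧ LipschitzOnWith 1 γ (Set.Icc 0 L)

/-- The sequence `z` converges to infinity: the Gromov products `(zₙ,zₘ)_x`
tend to infinity. -/
def ConvergesToInfinity {X : Type*} [MetricSpace X] (x : X) (z : ℕ → X) : Prop :=
  ∀ M : ℝ, ∃ N : ℕ, ∀ m n : ℕ, N ≤ m → N ≤ n → M ≤ gprod x (z m) (z n)

theorem points_close_to_an_infinite_geodesic {X : Type*} [MetricSpace X]
    {δ : ℝ} (hδ : 0 < δ) (hhyp : DeltaHyp X δ) (hlen : IsLengthSpace X)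
    (x : X) (z : ℕ → X) (hz : ConvergesToInfinity x z)
    (l : ℝ) (hl : 0 ≤ l) (η : ℝ) (hη : 0 < η) :
    ∃ y : X, dist x y = l ∧ ∃ N : ℕ, ∀ n : ℕ, N ≤ n → gprod y x (z n) ≤ δ + η := by
  obtain ⟨N, hN⟩ := hz l
  have hd : l ≤ dist x (z N) := by
    have h := hN N N le_rfl le_rfl
    simp only [gprod, dist_self] at h
    linarith
  obtain ⟨L, hL0, hL, γ, h0, h1, hγ⟩ := hlen x (z N) η hη
  have hcont : ContinuousOn (fun t => dist x (γ t)) (Set.Icc 0 L) :=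
    (Continuous.dist continuous_const continuous_id).comp_continuousOn hγ.continuousOn
  obtain ⟨t, ht, hty⟩ : l ∈ (fun t => dist x (γ t)) '' Set.Icc 0 L :=
    intermediate_value_Icc hL0 hcont (by simpa [h0, h1] using ⟨hl, hd⟩)
  have hxy : dist x (γ t) = l := hty
  have hxt : dist x (γ t) ≤ t := by
    have h := hγ.dist_le_mul 0 (Set.left_mem_Icc.2 hL0) t ht
    rw [h0, Real.dist_eq, zero_sub, abs_neg, abs_of_nonneg ht.1] at h
    simpa using h
  have htz : dist (γ t) (z N) ≤ L - t := by
    have h := hγ.dist_le_mul t ht L (Set.right_mem_Icc.2 hL0)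
    rw [h1, Real.dist_eq, abs_sub_comm, abs_of_nonneg (sub_nonneg.2 ht.2)] at h
    simpa using h
  refine ⟨γ t, hxy, N, fun n hn => ?_⟩
  have hhyp' := hhyp (γ t) (z N) (z n) x
  have hNn := hN N n le_rfl hn
  have hy : l - η ≤ gprod x (γ t) (z N) := by
    simp only [gprod]
    linarith
  have hmin : l - η ≤ min (gprod x (γ t) (z N)) (gprod x (z N) (z n)) :=
    le_min hy (by linarith)
  have hsum : gprod (γ t) x (z n) = l - gprod x (γ t) (z n) := by
    simp only [gprod, dist_comm (γ t) x, hxy]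
    ring
  linarith
end

section
/- Let δ > 0 and let X be a δ-hyperbolic length space. Let x ∈ X and let (zₙ) be a sequence in X converging to infinity. Then for every L > 0 and every l > 0 there exists an L-local (1, l+10δ)-quasi-geodesic γ : [0,∞) → X with γ(0) = x which converges to the same point at infinity as (zₙ); that is, for every M > 0 there exist T ≥ 0 and an integer N such that (γ(t), zₙ)_x ≥ M for all t ≥ T and all n ≥ N. -/
/-- `γ`, parametrized by arclength, is an `L`-local `(1,l)`-quasi-geodesic on the
set `s`: it is `1`-Lipschitz there, and `|t - t'| ≤ d(γ t, γ t') + l` whenever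
`|t - t'| ≤ L`. -/
def LocalQuasiGeodesicOn {X : Type*} [MetricSpace X] (γ : ℝ → X) (s : Set ℝ)
    (L l : ℝ) : Prop :=
  (∀ t ∈ s, ∀ t' ∈ s, dist (γ t) (γ t') ≤ |t - t'|) ∧
  (∀ t ∈ s, ∀ t' ∈ s, |t - t'| ≤ L → |t - t'| ≤ dist (γ t) (γ t') + l)

/-- A length space contains, between any two points at distance less than `ℓ`, a `1`-Lipschitz
path parametrized by `[0, ℓ]`. -/
lemma IsLengthSpace.exists_lipschitz_path {X : Type*} [MetricSpace X] (hlen : IsLengthSpace X)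
    {a b : X} {ℓ : ℝ} (h : dist a b < ℓ) :
    ∃ p : ℝ → X, p 0 = a ∧ p ℓ = b ∧
      ∀ s t : ℝ, 0 ≤ s → s ≤ t → t ≤ ℓ → dist (p s) (p t) ≤ t - s := by
  obtain ⟨L, hL0, hL, γ, h0, h1, hγ⟩ := hlen a b (ℓ - dist a b) (by linarith)
  refine ⟨fun t => γ (min t L), ?_, ?_, ?_⟩
  · simp [hL0, h0]
  · simp only
    rw [min_eq_right (by linarith), h1]
  · intro s t hs hst _
    have := hγ.dist_le_mul (min s L) ⟨le_min hs hL0, min_le_right _ _⟩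
      (min t L) ⟨le_min (hs.trans hst) hL0, min_le_right _ _⟩
    have h2 : |min s L - min t L| ≤ max |s - t| |L - L| := abs_min_sub_min_le_max _ _ _ _
    rw [Real.dist_eq, NNReal.coe_one, one_mul] at this
    rw [sub_self, abs_zero, max_eq_left (abs_nonneg _), abs_sub_comm s t,
      abs_of_nonneg (by linarith : 0 ≤ t - s)] at h2
    exact this.trans h2

/-- In a length space, there is a point at any prescribed distance `r ≤ dist x z` from `x` lying
almost on a geodesic from `x` to `z`. -/
lemma IsLengthSpace.exists_dist_eq_gprod_ge {X : Type*} [MetricSpace X] (hlen : IsLengthSpace X)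
    {x z : X} {r η : ℝ} (hη : 0 < η) (hr : 0 ≤ r) (hrz : r ≤ dist x z) :
    ∃ y : X, dist x y = r ∧ r - η ≤ gprod x y z := by
  obtain ⟨p, h0, h1, hp⟩ := hlen.exists_lipschitz_path (by linarith : dist x z < dist x z + η)
  set ℓ := dist x z + η with hℓ
  have hℓ0 : 0 ≤ ℓ := by positivity
  have hlip : LipschitzOnWith 1 p (Set.Icc 0 ℓ) := by
    refine LipschitzOnWith.of_dist_le_mul fun s hs t ht => ?_
    rw [NNReal.coe_one, one_mul, Real.dist_eq]
    rcases le_total s t with hst | hst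
    · rw [abs_sub_comm, abs_of_nonneg (by linarith)]
      exact hp s t hs.1 hst ht.2
    · rw [abs_of_nonneg (by linarith), dist_comm]
      exact hp t s ht.1 hst hs.2
  have hcont : ContinuousOn (fun t => dist x (p t)) (Set.Icc 0 ℓ) :=
    (continuous_const.dist continuous_id).comp_continuousOn hlip.continuousOn
  obtain ⟨s, hs, hsr⟩ := intermediate_value_Icc hℓ0 hcont
    (show r ∈ Set.Icc (dist x (p 0)) (dist x (p ℓ)) by rw [h0, h1, dist_self]; exact ⟨hr, hrz⟩)
  refine ⟨p s, hsr, ?_⟩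
  have hxs := hp 0 s le_rfl hs.1 hs.2
  have hsz := hp s ℓ hs.1 hs.2 le_rfl
  simp only at hsr
  rw [h0, hsr] at hxs
  rw [h1] at hsz
  unfold gprod
  linarith

/-- Points at successive distances at most `ℓ` in a length space are joined by a `1`-Lipschitz
ray passing through the `k`-th point at time `k * ℓ`. -/
lemma IsLengthSpace.exists_lipschitz_ray {X : Type*} [MetricSpace X] (hlen : IsLengthSpace X)
    {y : ℕ → X} {ℓ : ℝ} (hℓ : 0 < ℓ) (hy : ∀ k, dist (y k) (y (k + 1)) < ℓ) :
    ∃ γ : ℝ → X, (∀ k : ℕ, γ (k * ℓ) = y k) ∧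
      ∀ s t : ℝ, 0 ≤ s → s ≤ t → dist (γ s) (γ t) ≤ t - s := by
  choose p h0 h1 hp using fun k => hlen.exists_lipschitz_path (hy k)
  have hdist : ∀ a b : ℕ, a ≤ b → dist (y a) (y b) ≤ (b - a) * ℓ := by
    intro a b hab
    induction b, hab using Nat.le_induction with
    | base => simp
    | succ b _ ih =>
      have := dist_triangle (y a) (y b) (y (b + 1))
      have := hy b
      push_cast
      linarith
  refine ⟨fun t => p ⌊t / ℓ⌋₊ (t - ⌊t / ℓ⌋₊ * ℓ), ?_, ?_⟩
  · intro k
    simp [mul_div_cancel_right₀ _ hℓ.ne', h0]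
  · intro s t hs hst
    have ht : 0 ≤ t := hs.trans hst
    have hs1 := (le_div_iff₀ hℓ).1 (Nat.floor_le (div_nonneg hs hℓ.le))
    have hs2 := (div_lt_iff₀ hℓ).1 (Nat.lt_floor_add_one (s / ℓ))
    have ht1 := (le_div_iff₀ hℓ).1 (Nat.floor_le (div_nonneg ht hℓ.le))
    have ht2 := (div_lt_iff₀ hℓ).1 (Nat.lt_floor_add_one (t / ℓ))
    have hmono : ⌊s / ℓ⌋₊ ≤ ⌊t / ℓ⌋₊ := Nat.floor_mono (by gcongr)
    simp only
    generalize ⌊s / ℓ⌋₊ = a at *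
    generalize ⌊t / ℓ⌋₊ = b at *
    rcases hmono.eq_or_lt with rfl | hab
    · have := hp a (s - a * ℓ) (t - a * ℓ) (by linarith) (by linarith) (by linarith)
      linarith
    · have e1 := hp a (s - a * ℓ) ℓ (by linarith) (by linarith) le_rfl
      have e2 := hdist (a + 1) b hab
      have e3 := hp b 0 (t - b * ℓ) le_rfl (by linarith) (by linarith)
      rw [h1] at e1
      rw [h0] at e3
      push_cast at e2
      have := dist_triangle4 (p a (s - a * ℓ)) (y (a + 1)) (y b) (p b (t - b * ℓ))
      linarith

theorem quasi_ray_to_point_at_infinity {X : Type*} [MetricSpace X]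
    {δ : ℝ} (hδ : 0 < δ) (hhyp : DeltaHyp X δ) (hlen : IsLengthSpace X)
    (x : X) (z : ℕ → X) (hz : ConvergesToInfinity x z)
    (L l : ℝ) (hL : 0 < L) (hl : 0 < l) :
    ∃ γ : ℝ → X, γ 0 = x ∧ LocalQuasiGeodesicOn γ (Set.Ici 0) L (l + 10 * δ) ∧
      ∀ M : ℝ, 0 < M → ∃ T : ℝ, 0 ≤ T ∧ ∃ N : ℕ, ∀ t : ℝ, T ≤ t → ∀ n : ℕ, N ≤ n →
        M ≤ gprod x (γ t) (z n) := by
  choose N hN using fun k : ℕ => hz (k * L)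
  set m : ℕ → ℕ := fun k => partialSups N k with hm
  have hNm : ∀ j k, j ≤ k → N j ≤ m k := fun j k hjk => le_partialSups_of_le N hjk
  have hη : 0 < l / 6 := by positivity
  have hmz : ∀ k : ℕ, (k : ℝ) * L ≤ dist x (z (m k)) := fun k => by
    have := hN k (m k) (m k) (hNm k k le_rfl) (hNm k k le_rfl)
    simp only [gprod, dist_self] at this
    linarith
  choose y hyd hyz using fun k : ℕ =>
    hlen.exists_dist_eq_gprod_ge hη (by positivity : 0 ≤ (k : ℝ) * L) (hmz k)
  -- `y k` tracks all the far away terms of the sequence `z`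
  have hyn : ∀ j k n : ℕ, j ≤ k → N j ≤ n → j * L - l / 6 - δ ≤ gprod x (y k) (z n) := by
    intro j k n hjk hn
    have hjk' : (j : ℝ) * L ≤ k * L := by gcongr
    have h1 := hhyp (y k) (z (m k)) (z n) x
    have h2 : (j : ℝ) * L - l / 6 ≤ min (gprod x (y k) (z (m k))) (gprod x (z (m k)) (z n)) :=
      le_min (by linarith [hyz k]) (by linarith [hN j (m k) n (hNm j k hjk) hn])
    linarith
  set ℓ := L + 3 * (l / 6) + 4 * δ with hℓ
  have hℓ0 : 0 < ℓ := by positivity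
  have hy : ∀ k, dist (y k) (y (k + 1)) < ℓ := by
    intro k
    have h1 := hhyp (y k) (z (m (k + 1))) (y (k + 1)) x
    have h2 := hyn k k (m (k + 1)) le_rfl (hNm k (k + 1) k.le_succ)
    have h3 := hyz (k + 1)
    have h4 : gprod x (z (m (k + 1))) (y (k + 1)) = gprod x (y (k + 1)) (z (m (k + 1))) := by
      simp only [gprod, dist_comm (z (m (k + 1))) (y (k + 1))]
      ring
    push_cast at h3
    have h5 : (k : ℝ) * L - l / 6 - δ ≤
        min (gprod x (y k) (z (m (k + 1)))) (gprod x (z (m (k + 1))) (y (k + 1))) :=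
      le_min h2 (by rw [h4]; linarith)
    have h6 : (k : ℝ) * L - l / 6 - 2 * δ ≤ gprod x (y k) (y (k + 1)) := by linarith
    unfold gprod at h6
    rw [hyd, hyd] at h6
    push_cast at h6
    linarith
  obtain ⟨γ, hγy, hγ⟩ := hlen.exists_lipschitz_ray hℓ0 hy
  have hfloor : ∀ t : ℝ, 0 ≤ t → ⌊t / ℓ⌋₊ * ℓ ≤ t ∧ t < (⌊t / ℓ⌋₊ + 1) * ℓ := fun t ht =>
    ⟨(le_div_iff₀ hℓ0).1 (Nat.floor_le (div_nonneg ht hℓ0.le)),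
      (div_lt_iff₀ hℓ0).1 (Nat.lt_floor_add_one _)⟩
  have hquasi : ∀ s t : ℝ, 0 ≤ s → s ≤ t → t - s ≤ L →
      t - s ≤ dist (γ s) (γ t) + (l + 10 * δ) := by
    intro s t hs hst htL
    obtain ⟨h1, h2⟩ := hfloor s hs
    set k := ⌊s / ℓ⌋₊
    have e1 := hγ (k * ℓ) s (by positivity) h1
    have e2 := hγ t ((k + 2 : ℕ) * ℓ) (by linarith) (by push_cast; linarith)
    rw [hγy] at e1 e2
    have e3 := dist_triangle x (y k) (y (k + 2))
    rw [hyd, hyd] at e3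
    have e4 := dist_triangle4 (y k) (γ s) (γ t) (y (k + 2))
    push_cast at e2 e3
    linarith
  refine ⟨γ, ?_, ⟨?_, ?_⟩, ?_⟩
  · have h0 := hγy 0
    have h1 := hyd 0
    simp only [Nat.cast_zero, zero_mul] at h0 h1
    rw [h0, dist_eq_zero.1 h1]
  · intro s hs t ht
    rcases le_total s t with hst | hst
    · rw [abs_sub_comm, abs_of_nonneg (by linarith)]
      exact hγ s t hs hst
    · rw [abs_of_nonneg (by linarith), dist_comm]
      exact hγ t s ht hst
  · intro s hs t ht h
    rcases le_total s t with hst | hst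
    · rw [abs_sub_comm, abs_of_nonneg (by linarith)] at h ⊢
      exact hquasi s t hs hst h
    · rw [abs_of_nonneg (by linarith)] at h ⊢
      rw [dist_comm]
      exact hquasi t s ht hst h
  · intro M _
    obtain ⟨K, hK⟩ := exists_nat_ge ((M + l / 6 + δ + ℓ) / L)
    rw [div_le_iff₀ hL] at hK
    refine ⟨K * ℓ, by positivity, N K, fun t ht n hn => ?_⟩
    have ht0 : 0 ≤ t := le_trans (by positivity) ht
    obtain ⟨h1, h2⟩ := hfloor t ht0
    have hKk : K ≤ ⌊t / ℓ⌋₊ := Nat.le_floor ((le_div_iff₀ hℓ0).2 ht)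
    set k := ⌊t / ℓ⌋₊
    have e1 := hγ (k * ℓ) t (by positivity) h1
    rw [hγy] at e1
    have e2 := hyn K k n hKk hn
    have e3 := dist_triangle x (γ t) (y k)
    have e4 := dist_triangle (γ t) (y k) (z n)
    rw [dist_comm (γ t) (y k)] at e3 e4
    unfold gprod at e2 ⊢
    linarith
end

section
/- Let δ ≥ 0 and let X be a δ-hyperbolic length space. Let Y be an α-quasi-convex subset of X and let A > α + 2δ. Let Z = {x ∈ X : d(x,Y) < A} be the open A-neighborhood of Y. Then: (1) Z is 2δ-quasi-convex; and (2) for all z₁, z₂ ∈ Z and every ε > 0 there exists a rectifiable path contained in Z joining z₁ to z₂ whose length is at most d(z₁,z₂) + 8δ + ε. -/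
/-- `Y` is `α`-quasi-convex: `d(x,Y) ≤ (y,y')_x + α` for every `x ∈ X` and
`y, y' ∈ Y`. -/
def QConvex {X : Type*} [MetricSpace X] (α : ℝ) (Y : Set X) : Prop :=
  ∀ x : X, ∀ y ∈ Y, ∀ y' ∈ Y, Metric.infDist x Y ≤ gprod x y y' + α

open Set Metric

section

variable {X : Type*} [MetricSpace X]

/-- `x` and `y` are joined inside `S` by a path of length at most `L`, given by a `1`-Lipschitz
parametrization on `[0, L]`. -/
def JoinedWithin (S : Set X) (L : ℝ) (x y : X) : Prop :=
  0 ≤ L ∧ ∃ γ : ℝ → X, γ 0 = x ∧ γ L = y ∧ LipschitzOnWith 1 γ (Icc 0 L) ∧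
    ∀ t ∈ Icc (0 : ℝ) L, γ t ∈ S

theorem lipschitzOnWith_one_of_le {γ : ℝ → X} {s : Set ℝ}
    (h : ∀ a ∈ s, ∀ b ∈ s, a ≤ b → dist (γ a) (γ b) ≤ b - a) : LipschitzOnWith 1 γ s := by
  refine LipschitzOnWith.of_dist_le_mul fun a ha b hb => ?_
  rw [NNReal.coe_one, one_mul, Real.dist_eq]
  rcases le_total a b with hab | hab
  · rw [abs_sub_comm, abs_of_nonneg (sub_nonneg.2 hab)]
    exact h a ha b hb hab
  · rw [dist_comm, abs_of_nonneg (sub_nonneg.2 hab)]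
    exact h b hb a ha hab

theorem LipschitzOnWith.dist_le_sub {γ : ℝ → X} {s : Set ℝ} (h : LipschitzOnWith 1 γ s)
    {a b : ℝ} (ha : a ∈ s) (hb : b ∈ s) (hab : a ≤ b) : dist (γ a) (γ b) ≤ b - a := by
  have := h.dist_le_mul a ha b hb
  rwa [NNReal.coe_one, one_mul, Real.dist_eq, abs_sub_comm,
    abs_of_nonneg (sub_nonneg.2 hab)] at this

theorem JoinedWithin.symm {S : Set X} {L : ℝ} {x y : X} (h : JoinedWithin S L x y) :
    JoinedWithin S L y x := by
  obtain ⟨hL, γ, h0, h1, hγ, hS⟩ := h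
  have hmem : ∀ t ∈ Icc (0 : ℝ) L, L - t ∈ Icc (0 : ℝ) L := fun t ht =>
    ⟨by linarith [ht.2], by linarith [ht.1]⟩
  refine ⟨hL, fun t => γ (L - t), by simpa using h1, by simpa using h0, ?_,
    fun t ht => hS _ (hmem t ht)⟩
  refine lipschitzOnWith_one_of_le fun a ha b hb hab => ?_
  rw [dist_comm]
  exact (hγ.dist_le_sub (hmem b hb) (hmem a ha) (by linarith)).trans (by linarith)

theorem JoinedWithin.trans {S : Set X} {L M : ℝ} {x y z : X} (hxy : JoinedWithin S L x y)
    (hyz : JoinedWithin S M y z) : JoinedWithin S (L + M) x z := by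
  obtain ⟨hL, γ, h0, h1, hγ, hS⟩ := hxy
  obtain ⟨hM, σ, k0, k1, hσ, hT⟩ := hyz
  have hleft : ∀ t, t ≤ L → (if t ≤ L then γ t else σ (t - L)) = γ t := fun t ht => if_pos ht
  have hright : ∀ t, L ≤ t → (if t ≤ L then γ t else σ (t - L)) = σ (t - L) := by
    intro t ht
    split_ifs with h
    · rw [le_antisymm h ht, sub_self, h1, k0]
    · rfl
  refine ⟨add_nonneg hL hM, fun t => if t ≤ L then γ t else σ (t - L), ?_, ?_, ?_, ?_⟩
  · simpa only [hleft 0 hL] using h0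
  · simp only
    rw [hright (L + M) (by linarith), add_sub_cancel_left, k1]
  · refine lipschitzOnWith_one_of_le fun a ha b hb hab => ?_
    have hmid : b - L ≤ M := by linarith [hb.2]
    rcases le_total b L with hbL | hLb
    · rw [hleft a (hab.trans hbL), hleft b hbL]
      exact hγ.dist_le_sub ⟨ha.1, hab.trans hbL⟩ ⟨hb.1, hbL⟩ hab
    rcases le_total a L with haL | hLa
    · rw [hleft a haL, hright b hLb]
      have e₁ := hγ.dist_le_sub ⟨ha.1, haL⟩ ⟨hL, le_rfl⟩ haL
      have e₂ := hσ.dist_le_sub ⟨le_rfl, hM⟩ ⟨sub_nonneg.2 hLb, hmid⟩ (sub_nonneg.2 hLb)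
      rw [h1] at e₁
      rw [k0] at e₂
      linarith [dist_triangle (γ a) y (σ (b - L))]
    · rw [hright a hLa, hright b hLb]
      exact (hσ.dist_le_sub ⟨sub_nonneg.2 hLa, by linarith⟩ ⟨sub_nonneg.2 hLb, hmid⟩
        (by linarith)).trans (by linarith)
  · intro t ht
    simp only
    rcases le_total t L with h | h
    · rw [hleft t h]
      exact hS t ⟨ht.1, h⟩
    · rw [hright t h]
      exact hT _ ⟨sub_nonneg.2 h, by linarith [ht.2]⟩

theorem gprod_nonneg (x y z : X) : 0 ≤ gprod x y z := by
  unfold gprod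
  linarith [dist_triangle_left y z x]

/-- On a path from `x` to `y` of length at most `d(x,y) + ε`, Gromov products of the endpoints
are at most `ε / 2`. -/
theorem gprod_le_of_lipschitzOnWith {γ : ℝ → X} {L ε : ℝ}
    (hγ : LipschitzOnWith 1 γ (Icc 0 L)) (hL : L ≤ dist (γ 0) (γ L) + ε) {t : ℝ}
    (ht : t ∈ Icc 0 L) : gprod (γ t) (γ 0) (γ L) ≤ ε / 2 := by
  have h0L : 0 ≤ L := ht.1.trans ht.2
  have e₁ := hγ.dist_le_sub ⟨le_rfl, h0L⟩ ht ht.1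
  have e₂ := hγ.dist_le_sub ht ⟨h0L, le_rfl⟩ ht.2
  rw [dist_comm] at e₁
  unfold gprod
  linarith

theorem QConvex.nonneg {α : ℝ} {Y : Set X} (hY : QConvex α Y) (hne : Y.Nonempty) : 0 ≤ α := by
  obtain ⟨y, hy⟩ := hne
  simpa [gprod, infDist_zero_of_mem hy] using hY y y hy y hy

/-- In a length space, a point outside the open `A`-neighborhood of `Y` is at distance at most
`d(x,Y) - A` from it. -/
theorem IsLengthSpace.infDist_neighborhood_le (hlen : IsLengthSpace X) {Y : Set X}
    (hne : Y.Nonempty) {A : ℝ} (hA : 0 < A) {x : X} (hx : A ≤ infDist x Y) :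
    infDist x {z | infDist z Y < A} ≤ infDist x Y - A := by
  refine le_of_forall_pos_le_add fun ε hε => ?_
  obtain ⟨η, hη, hηA, hηε⟩ : ∃ η : ℝ, 0 < η ∧ η ≤ A ∧ 3 * η ≤ ε :=
    ⟨min A (ε / 3), lt_min hA (by linarith), min_le_left _ _,
      by linarith [min_le_right A (ε / 3)]⟩
  obtain ⟨y, hy, hxy⟩ := (infDist_lt_iff hne).1 (lt_add_of_pos_right (infDist x Y) hη)
  obtain ⟨L, hL0, hL, γ, h0, h1, hγ⟩ := hlen y x η hη
  have hyx := hγ.dist_le_sub ⟨le_rfl, hL0⟩ ⟨hL0, le_rfl⟩ hL0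
  rw [h0, h1, dist_comm] at hyx
  have hAL : A ≤ L := by linarith [infDist_le_dist_of_mem (x := x) hy]
  have hmem : A - η ∈ Icc (0 : ℝ) L := ⟨by linarith, by linarith⟩
  have e₁ := hγ.dist_le_sub ⟨le_rfl, hL0⟩ hmem hmem.1
  have e₂ := hγ.dist_le_sub hmem ⟨hL0, le_rfl⟩ hmem.2
  rw [h0, dist_comm] at e₁
  rw [h1, dist_comm] at e₂
  have hZ : γ (A - η) ∈ {z | infDist z Y < A} :=
    (infDist_le_dist_of_mem hy).trans_lt (by linarith)
  rw [dist_comm] at hL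
  linarith [infDist_le_dist_of_mem (x := x) hZ]

/-- The open `A`-neighborhood of an `α`-quasi-convex set is `2δ`-quasi-convex as soon as
`α ≤ A`. -/
theorem QConvex.neighborhood {δ : ℝ} (hδ : 0 ≤ δ) (hhyp : DeltaHyp X δ)
    (hlen : IsLengthSpace X) {α : ℝ} {Y : Set X} (hY : QConvex α Y) {A : ℝ} (hA : α ≤ A) :
    QConvex (2 * δ) {x : X | infDist x Y < A} := by
  intro x z hz z' hz'
  by_cases hx : infDist x Y < A
  · rw [infDist_zero_of_mem (show x ∈ {x : X | infDist x Y < A} from hx)]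
    linarith [gprod_nonneg x z z']
  have hne : Y.Nonempty := by
    rw [nonempty_iff_ne_empty]
    rintro rfl
    exact hx (by simpa using hz)
  obtain ⟨y, hy, hzy⟩ := (infDist_lt_iff hne).1 hz
  obtain ⟨y', hy', hzy'⟩ := (infDist_lt_iff hne).1 hz'
  have hA0 : 0 < A := dist_nonneg.trans_lt hzy
  have hd := hlen.infDist_neighborhood_le hne hA0 (not_lt.1 hx)
  have hxz := infDist_le_dist_of_mem (x := x) hz
  have hxz' := infDist_le_dist_of_mem (x := x) hz'
  have hxy := infDist_le_dist_of_mem (x := x) hy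
  have hxy' := infDist_le_dist_of_mem (x := x) hy'
  have k₁ : infDist x {x : X | infDist x Y < A} ≤ gprod x z y := by
    unfold gprod
    linarith
  have k₂ : infDist x {x : X | infDist x Y < A} ≤ gprod x y y' := by
    linarith [hY x y hy y' hy']
  have k₃ : infDist x {x : X | infDist x Y < A} ≤ gprod x y' z' := by
    unfold gprod
    linarith [dist_comm y' z']
  have m₁ := hhyp z y z' x
  have m₂ := hhyp y y' z' x
  have m₃ := le_min k₂ k₃
  have m₄ : infDist x {x : X | infDist x Y < A} - δ ≤ min (gprod x z y) (gprod x y z') :=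
    le_min (by linarith) (by linarith)
  linarith

/-- From a point of the open `A`-neighborhood of `Y`, one reaches the open `(A - c)`-neighborhood
by a path of length at most `c` inside the `A`-neighborhood. -/
theorem IsLengthSpace.exists_joinedWithin_neighborhood (hlen : IsLengthSpace X) {Y : Set X}
    (hne : Y.Nonempty) {A c : ℝ} (hc : 0 ≤ c) (hcA : c < A) {z : X} (hz : infDist z Y < A) :
    ∃ p, infDist p Y < A - c ∧ dist z p ≤ c ∧
      ∃ L ≤ c, JoinedWithin {x | infDist x Y < A} L z p := by
  obtain ⟨y, hy, hzy⟩ := (infDist_lt_iff hne).1 hz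
  obtain ⟨L, hL0, hL, γ, h0, h1, hγ⟩ := hlen z y ((A - dist z y) / 2) (by linarith)
  have hdist : ∀ t ∈ Icc (0 : ℝ) L, infDist (γ t) Y ≤ L - t := fun t ht =>
    (infDist_le_dist_of_mem hy).trans (h1 ▸ hγ.dist_le_sub ht ⟨hL0, le_rfl⟩ ht.2)
  have hmem : min L c ∈ Icc (0 : ℝ) L := ⟨le_min hL0 hc, min_le_left _ _⟩
  refine ⟨γ (min L c), ?_, ?_, min L c, min_le_right _ _, hmem.1, γ, h0, rfl,
    hγ.mono (Icc_subset_Icc_right hmem.2), fun t ht => ?_⟩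
  · have := hdist _ hmem
    rcases min_choice L c with h | h <;> rw [h] at this ⊢ <;> linarith
  · have := hγ.dist_le_sub ⟨le_rfl, hL0⟩ hmem hmem.1
    rw [h0] at this
    linarith [min_le_right L c]
  · have := hdist t ⟨ht.1, ht.2.trans hmem.2⟩
    simp only [mem_ofPred_eq]
    linarith [ht.1]

end

theorem open_neighborhood_strongly_quasiconvex {X : Type*} [MetricSpace X]
    {δ : ℝ} (hδ : 0 ≤ δ) (hhyp : DeltaHyp X δ) (hlen : IsLengthSpace X)
    (α : ℝ) (Y : Set X) (hY : QConvex α Y) (A : ℝ) (hA : α + 2 * δ < A) :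
    QConvex (2 * δ) {x : X | Metric.infDist x Y < A} ∧
    ∀ z₁ z₂ : X, Metric.infDist z₁ Y < A → Metric.infDist z₂ Y < A →
      ∀ ε : ℝ, 0 < ε →
        ∃ L : ℝ, 0 ≤ L ∧ L ≤ dist z₁ z₂ + 8 * δ + ε ∧
          ∃ γ : ℝ → X, γ 0 = z₁ ∧ γ L = z₂ ∧ LipschitzOnWith 1 γ (Set.Icc 0 L) ∧
            ∀ t ∈ Set.Icc (0 : ℝ) L, Metric.infDist (γ t) Y < A := by
  refine ⟨hY.neighborhood hδ hhyp hlen (by linarith), fun z₁ z₂ hz₁ hz₂ ε hε => ?_⟩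
  rcases Y.eq_empty_or_nonempty with rfl | hne
  · obtain ⟨L, hL0, hL, γ, h0, h1, hγ⟩ := hlen z₁ z₂ ε hε
    exact ⟨L, hL0, by linarith, γ, h0, h1, hγ, fun t _ => by simpa using hz₁⟩
  have hα := hY.nonneg hne
  obtain ⟨η, hη, hηA, hηε⟩ : ∃ η : ℝ, 0 < η ∧ 2 * η < A - α - 2 * δ ∧ 9 * η ≤ ε :=
    ⟨min ((A - α - 2 * δ) / 3) (ε / 9), lt_min (by linarith) (by linarith),
      by linarith [min_le_left ((A - α - 2 * δ) / 3) (ε / 9)],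
      by linarith [min_le_right ((A - α - 2 * δ) / 3) (ε / 9)]⟩
  have hc : 0 ≤ 2 * δ + 2 * η := by linarith
  have hcA : 2 * δ + 2 * η < A := by linarith
  obtain ⟨p₁, hp₁, hd₁, L₁, hL₁, hj₁⟩ := hlen.exists_joinedWithin_neighborhood hne hc hcA hz₁
  obtain ⟨p₂, hp₂, hd₂, L₂, hL₂, hj₂⟩ := hlen.exists_joinedWithin_neighborhood hne hc hcA hz₂
  obtain ⟨L, hL0, hL, γ, rfl, rfl, hγ⟩ := hlen p₁ p₂ η hη
  have hZ : QConvex (2 * δ) {x : X | infDist x Y < A - (2 * δ + 2 * η)} :=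
    hY.neighborhood hδ hhyp hlen (by linarith)
  have hj : JoinedWithin {x | infDist x Y < A} L (γ 0) (γ L) := by
    refine ⟨hL0, γ, rfl, rfl, hγ, fun t ht => ?_⟩
    have hq := hZ (γ t) _ hp₁ _ hp₂
    have hlt : infDist (γ t) {x : X | infDist x Y < A - (2 * δ + 2 * η)} < 2 * δ + η := by
      linarith [gprod_le_of_lipschitzOnWith hγ hL ht]
    obtain ⟨w, hw, hdw⟩ := (infDist_lt_iff (nonempty_of_mem (x := γ 0) hp₁)).1 hlt
    have hw' : infDist w Y < A - (2 * δ + 2 * η) := hw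
    have := infDist_le_infDist_add_dist (s := Y) (x := γ t) (y := w)
    simp only [mem_ofPred_eq]
    linarith
  obtain ⟨hM, σ, h0, h1, hσ, hS⟩ := (hj₁.trans hj).trans hj₂.symm
  refine ⟨_, hM, ?_, σ, h0, h1, hσ, hS⟩
  have e := dist_triangle4 (γ 0) z₁ z₂ (γ L)
  rw [dist_comm (γ 0) z₁] at e
  linarith
end

section
/- Let δ ≥ 0 and let X be a δ-hyperbolic length space. Then for every isometry g of X, [g]^∞ ≤ [g] ≤ [g]^∞ + 32δ, where [g] = inf_{x∈X} d(gx,x) is the translation length of g and [g]^∞ = lim_{n→∞} d(gⁿx,x)/n is its asymptotic translation length. -/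
/-- The translation length of a self-map `g` of `X`. -/
noncomputable def translationLength {X : Type*} [MetricSpace X] (g : X → X) : ℝ :=
  ⨅ x : X, dist (g x) x

/-- The four-point inequality for sums of opposite distances. -/
theorem DeltaHyp.four_point {X : Type*} [MetricSpace X] {δ : ℝ} (h : DeltaHyp X δ)
    (x y z t : X) :
    dist x z + dist y t ≤ max (dist x y + dist z t) (dist x t + dist y z) + 2 * δ := by
  have h₁ := h x y z t
  simp only [gprod, ge_iff_le, sub_le_iff_le_add, min_le_iff, dist_comm t] at h₁
  rcases h₁ with h₁ | h₁
  · linarith [le_max_left (dist x y + dist z t) (dist x t + dist y z)]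
  · linarith [le_max_right (dist x y + dist z t) (dist x t + dist y z)]

theorem IsLengthSpace.exists_approx_midpoint {X : Type*} [MetricSpace X]
    (h : IsLengthSpace X) (x y : X) {ε : ℝ} (hε : 0 < ε) :
    ∃ m : X, dist x m ≤ (dist x y + ε) / 2 ∧ dist m y ≤ (dist x y + ε) / 2 := by
  obtain ⟨L, hL, hLε, γ, rfl, rfl, hγ⟩ := h x y ε hε
  have h₀ : (0 : ℝ) ∈ Set.Icc 0 L := ⟨le_rfl, hL⟩
  have h₁ : L ∈ Set.Icc 0 L := ⟨hL, le_rfl⟩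
  have h₂ : L / 2 ∈ Set.Icc 0 L := ⟨by linarith, by linarith⟩
  refine ⟨γ (L / 2), (hγ.dist_le_mul _ h₀ _ h₂).trans ?_, (hγ.dist_le_mul _ h₂ _ h₁).trans ?_⟩
  · rw [Real.dist_eq, abs_of_nonpos (by linarith)]
    simp only [NNReal.coe_one]
    linarith
  · rw [Real.dist_eq, abs_of_nonpos (by linarith)]
    simp only [NNReal.coe_one]
    linarith

theorem Isometry.iterate {X : Type*} [MetricSpace X] {g : X → X} (hg : Isometry g) (n : ℕ) :
    Isometry g^[n] := by
  induction n with
  | zero => exact isometry_id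
  | succ n ih => exact ih.comp hg

/-- The asymptotic translation length does not depend on the base point. -/
theorem Isometry.tendsto_dist_iterate_div {X : Type*} [MetricSpace X] {g : X → X}
    (hg : Isometry g) {x : X} {ℓ : ℝ}
    (hlim : Filter.Tendsto (fun n : ℕ => dist (g^[n] x) x / n) Filter.atTop (nhds ℓ)) (y : X) :
    Filter.Tendsto (fun n : ℕ => dist (g^[n] y) y / n) Filter.atTop (nhds ℓ) := by
  have h₀ := tendsto_const_div_atTop_nhds_zero_nat (2 * dist x y)
  refine tendsto_of_tendsto_of_tendsto_of_le_of_le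
    (by simpa using hlim.sub h₀) (by simpa using hlim.add h₀) (fun n => ?_) (fun n => ?_)
  all_goals
    have hxy : dist (g^[n] x) (g^[n] y) = dist x y := (hg.iterate n).dist_eq x y
    simp only [← sub_div, ← add_div]
    gcongr
  · linarith [dist_triangle4 (g^[n] x) (g^[n] y) y x, dist_comm x y]
  · linarith [dist_triangle4 (g^[n] y) (g^[n] x) x y, dist_comm (g^[n] x) (g^[n] y)]

theorem Isometry.dist_iterate_le {X : Type*} [MetricSpace X] {g : X → X} (hg : Isometry g)
    (x : X) (n : ℕ) : dist (g^[n] x) x ≤ n * dist (g x) x := by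
  induction n with
  | zero => simp
  | succ n ih =>
    have h₁ : dist (g^[n] (g x)) (g^[n] x) = dist (g x) x := (hg.iterate n).dist_eq _ _
    rw [Function.iterate_succ_apply]
    push_cast
    linarith [dist_triangle (g^[n] (g x)) (g^[n] x) x]

theorem Isometry.asymptotic_le_dist {X : Type*} [MetricSpace X] {g : X → X} (hg : Isometry g)
    {x : X} {ℓ : ℝ}
    (hlim : Filter.Tendsto (fun n : ℕ => dist (g^[n] x) x / n) Filter.atTop (nhds ℓ)) :
    ℓ ≤ dist (g x) x := by
  refine le_of_tendsto hlim ?_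
  filter_upwards [Filter.eventually_gt_atTop 0] with n hn
  rw [div_le_iff₀ (by exact_mod_cast hn), mul_comm]
  exact hg.dist_iterate_le x n

/-- If `d(g²x, x)` exceeds `d(gx, x)` by more than `2δ`, the orbit of `x` escapes at linear
speed. -/
theorem DeltaHyp.dist_iterate_succ {X : Type*} [MetricSpace X] {δ : ℝ} (hhyp : DeltaHyp X δ)
    (hδ : 0 ≤ δ) {g : X → X} (hg : Isometry g) {x : X} {a : ℝ} (ha : 0 < a)
    (h : dist (g x) x + 2 * δ + a ≤ dist (g (g x)) x) (n : ℕ) :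
    dist (g^[n + 1] x) x + a ≤ dist (g^[n + 2] x) x := by
  induction n with
  | zero =>
    simp only [Function.iterate_succ_apply, Function.iterate_zero_apply]
    linarith
  | succ n ih =>
    have h₁ : dist (g^[n + 2] x) (g^[n + 1] x) = dist (g x) x :=
      (hg.iterate (n + 1)).dist_eq (g x) x
    have h₂ : dist (g^[n + 3] x) (g^[n + 2] x) = dist (g x) x :=
      (hg.iterate (n + 2)).dist_eq (g x) x
    have h₃ : dist (g^[n + 3] x) (g^[n + 1] x) = dist (g (g x)) x :=
      (hg.iterate (n + 1)).dist_eq (g (g x)) x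
    have h₄ := hhyp.four_point (g^[n + 2] x) (g^[n + 1] x) x (g^[n + 3] x)
    rw [dist_comm (g^[n + 1] x) (g^[n + 3] x), h₁, h₃, dist_comm (g^[n + 2] x) (g^[n + 3] x),
      h₂, dist_comm x] at h₄
    rw [← sub_le_iff_le_add, le_max_iff] at h₄
    rcases h₄ with h₄ | h₄ <;> linarith

theorem DeltaHyp.dist_sq_le {X : Type*} [MetricSpace X] {δ : ℝ} (hhyp : DeltaHyp X δ)
    (hδ : 0 ≤ δ) {g : X → X} (hg : Isometry g) {x : X} {ℓ : ℝ}
    (hlim : Filter.Tendsto (fun n : ℕ => dist (g^[n] x) x / n) Filter.atTop (nhds ℓ)) :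
    dist (g (g x)) x ≤ dist (g x) x + ℓ + 2 * δ := by
  have hℓ : 0 ≤ ℓ := ge_of_tendsto' hlim fun n => by positivity
  by_contra! hlt
  set a := dist (g (g x)) x - dist (g x) x - 2 * δ with ha
  have ha₀ : 0 < a := by linarith
  have hlin (n : ℕ) : n * a ≤ dist (g^[n + 1] x) x := by
    induction n with
    | zero => simp
    | succ n ih =>
      have := hhyp.dist_iterate_succ hδ hg ha₀ (by linarith) n
      push_cast
      linarith
  have hle : a ≤ ℓ := by
    have h₀ := (tendsto_const_div_atTop_nhds_zero_nat a).const_sub a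
    rw [sub_zero] at h₀
    refine le_of_tendsto_of_tendsto h₀ hlim ?_
    filter_upwards [Filter.eventually_gt_atTop 0] with n hn
    obtain ⟨k, rfl⟩ := Nat.exists_eq_succ_of_ne_zero hn.ne'
    have hk : (0 : ℝ) < (k.succ : ℝ) := by positivity
    rw [le_div_iff₀ hk, sub_mul, div_mul_cancel₀ _ hk.ne']
    have := hlin k
    push_cast
    linarith
  linarith

/-- An approximate midpoint of `x` and `gx` is moved by at most about
`max 0 (d(g²x, x) - d(gx, x)) + 4δ`. -/
theorem DeltaHyp.dist_map_midpoint_le {X : Type*} [MetricSpace X] {δ : ℝ}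
    (hhyp : DeltaHyp X δ) (hδ : 0 ≤ δ) {g : X → X} (hg : Isometry g) {x m : X} {ε : ℝ}
    (hε : 0 < ε) (h₁ : dist x m ≤ (dist x (g x) + ε) / 2)
    (h₂ : dist m (g x) ≤ (dist x (g x) + ε) / 2) :
    dist (g m) m ≤ max 0 (dist (g (g x)) x - dist (g x) x) + 4 * δ + 2 * ε := by
  have h₃ : dist (g x) (g m) = dist x m := hg.dist_eq _ _
  have h₄ : dist (g m) (g (g x)) = dist m (g x) := hg.dist_eq _ _
  have h₅ : dist (g x) (g (g x)) = dist x (g x) := hg.dist_eq _ _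
  have h₆ := hhyp.four_point (g m) x m (g x)
  have h₇ := hhyp.four_point (g m) (g x) x (g (g x))
  rw [← sub_le_iff_le_add, le_max_iff] at h₆ h₇
  simp only [dist_comm (g m) (g x), dist_comm (g m) x, dist_comm (g x) x,
    dist_comm (g (g x)) x] at *
  have h₈ := le_max_left 0 (dist x (g (g x)) - dist x (g x))
  have h₉ := le_max_right 0 (dist x (g (g x)) - dist x (g x))
  rcases h₆ with h₆ | h₆ <;> rcases h₇ with h₇ | h₇ <;> linarith

theorem translation_length_vs_asymptotic_translation_length
    {X : Type*} [MetricSpace X] [Nonempty X] {δ : ℝ} (hδ : 0 ≤ δ)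
    (hhyp : DeltaHyp X δ) (hlen : IsLengthSpace X)
    (g : X → X) (hg : Isometry g) (hgs : Function.Surjective g)
    (x : X) (ℓ : ℝ)
    (hlim : Filter.Tendsto (fun n : ℕ => dist (g^[n] x) x / n) Filter.atTop (nhds ℓ)) :
    ℓ ≤ translationLength g ∧ translationLength g ≤ ℓ + 32 * δ := by
  have hbdd : BddBelow (Set.range fun y : X => dist (g y) y) :=
    ⟨0, Set.forall_mem_range.2 fun _ => dist_nonneg⟩
  refine ⟨le_ciInf fun y => hg.asymptotic_le_dist (hg.tendsto_dist_iterate_div hlim y),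
    le_of_forall_pos_le_add fun ε hε => ?_⟩
  have hℓ : 0 ≤ ℓ := ge_of_tendsto' hlim fun n => by positivity
  obtain ⟨m, h₁, h₂⟩ := hlen.exists_approx_midpoint x (g x) (half_pos hε)
  have h₃ := hhyp.dist_map_midpoint_le hδ hg (half_pos hε) h₁ h₂
  have h₄ : max 0 (dist (g (g x)) x - dist (g x) x) ≤ ℓ + 2 * δ :=
    max_le (by linarith) (by linarith [hhyp.dist_sq_le hδ hg hlim])
  have h₅ : translationLength g ≤ dist (g m) m := ciInf_le hbdd m
  linarith
end

section
/- Let δ ≥ 0, let X be a δ-hyperbolic length space, and let G be a group acting by isometries on X. Let x ∈ X. If the orbit G·x is unbounded, then there exists a sequence (gₙ) of elements of G such that the sequence (gₙ·x) converges to infinity, i.e. (gₙ·x, gₘ·x)_x tends to infinity as n and m tend to infinity. -/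
theorem gprod_comm {X : Type*} [MetricSpace X] (x y z : X) : gprod x y z = gprod x z y := by
  unfold gprod
  rw [dist_comm y z]
  ring

theorem gprod_add_gprod {X : Type*} [MetricSpace X] (x y z : X) :
    gprod x y z + gprod y x z = dist x y := by
  unfold gprod
  rw [dist_comm y x]
  ring

theorem gprod_smul {X : Type*} [MetricSpace X] {G : Type*} [Group G] [MulAction G X]
    (hiso : ∀ u : G, Isometry (fun y : X => u • y)) (u : G) (x y z : X) :
    gprod (u • x) (u • y) (u • z) = gprod x y z := by
  have h (a b : X) : dist (u • a) (u • b) = dist a b := (hiso u).dist_eq a b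
  simp only [gprod, h]

/-- Discrete paths in a hyperbolic space whose steps have length at least `L` and whose Gromov
products at consecutive points are at most `L / 2 - (2 * δ + 1)`. -/
structure IsLocalQuasiGeodesic {X : Type*} [MetricSpace X] (δ L : ℝ) (p : ℕ → X) : Prop where
  le_dist : ∀ n, L ≤ dist (p n) (p (n + 1))
  gprod_le : ∀ n, gprod (p (n + 1)) (p n) (p (n + 2)) ≤ L / 2 - (2 * δ + 1)

namespace IsLocalQuasiGeodesic

variable {X : Type*} [MetricSpace X] {δ L : ℝ} {p : ℕ → X}

theorem gprod_last_le (hp : IsLocalQuasiGeodesic δ L p) (hδ : 0 ≤ δ) (hhyp : DeltaHyp X δ)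
    (n : ℕ) : gprod (p (n + 1)) (p 0) (p (n + 2)) ≤ L / 2 - (δ + 1) := by
  induction n with
  | zero => linarith [hp.gprod_le 0]
  | succ n ih =>
    have h₁ := hhyp (p (n + 1)) (p 0) (p (n + 3)) (p (n + 2))
    have h₂ := hp.gprod_le (n + 1)
    have h₃ := hp.le_dist (n + 1)
    have h₄ := gprod_add_gprod (p (n + 1)) (p (n + 2)) (p 0)
    rw [gprod_comm _ (p (n + 2))] at h₄
    simp only [add_assoc, Nat.reduceAdd] at *
    rcases min_cases (gprod (p (n + 2)) (p (n + 1)) (p 0)) (gprod (p (n + 2)) (p 0) (p (n + 3)))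
      with h | h <;> linarith

theorem gprod_first_le (hp : IsLocalQuasiGeodesic δ L p) (hδ : 0 ≤ δ) (hhyp : DeltaHyp X δ)
    (n m : ℕ) : gprod (p (m + 1)) (p m) (p (m + n + 2)) ≤ L / 2 - (δ + 1) := by
  induction n generalizing m with
  | zero => linarith [hp.gprod_le m]
  | succ n ih =>
    have h₀ := ih (m + 1)
    have h₁ := hhyp (p m) (p (m + (n + 1) + 2)) (p (m + 2)) (p (m + 1))
    have h₂ := hp.gprod_le m
    have h₃ := hp.le_dist (m + 1)
    have h₄ := gprod_add_gprod (p (m + 1)) (p (m + 2)) (p (m + (n + 1) + 2))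
    rw [show m + 1 + n + 2 = m + (n + 1) + 2 by ring] at h₀
    rw [gprod_comm _ (p (m + 2))] at h₄
    simp only [add_assoc, Nat.reduceAdd] at *
    rcases min_cases (gprod (p (m + 1)) (p m) (p (m + (n + 3))))
      (gprod (p (m + 1)) (p (m + (n + 3))) (p (m + 2))) with h | h <;> linarith

theorem gprod_middle_le (hp : IsLocalQuasiGeodesic δ L p) (hδ : 0 ≤ δ) (hhyp : DeltaHyp X δ)
    (m n : ℕ) : gprod (p (m + 1)) (p 0) (p (m + n + 2)) ≤ L / 2 - 1 := by
  rcases n with _ | n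
  · linarith [hp.gprod_last_le hδ hhyp m]
  · have h₁ := hhyp (p 0) (p (m + (n + 1) + 2)) (p (m + 2)) (p (m + 1))
    have h₂ := hp.gprod_last_le hδ hhyp m
    have h₃ := hp.le_dist (m + 1)
    have h₄ := gprod_add_gprod (p (m + 1)) (p (m + 2)) (p (m + (n + 1) + 2))
    have h₅ := hp.gprod_first_le hδ hhyp n (m + 1)
    rw [show m + 1 + n + 2 = m + (n + 1) + 2 by ring] at h₅
    rw [gprod_comm _ (p (m + 2))] at h₄
    simp only [add_assoc, Nat.reduceAdd] at *
    rcases min_cases (gprod (p (m + 1)) (p 0) (p (m + (n + 3))))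
      (gprod (p (m + 1)) (p (m + (n + 3))) (p (m + 2))) with h | h <;> linarith

theorem le_dist_zero (hp : IsLocalQuasiGeodesic δ L p) (hδ : 0 ≤ δ) (hhyp : DeltaHyp X δ)
    (n : ℕ) : (n : ℝ) ≤ dist (p 0) (p (n + 1)) := by
  induction n with
  | zero => simp
  | succ n ih =>
    have h₁ := hp.gprod_last_le hδ hhyp n
    have h₂ := hp.le_dist (n + 1)
    unfold gprod at h₁
    rw [dist_comm (p (n + 1)) (p 0)] at h₁
    push_cast
    simp only [add_assoc, Nat.reduceAdd] at *
    linarith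

theorem convergesToInfinity (hp : IsLocalQuasiGeodesic δ L p) (hδ : 0 ≤ δ)
    (hhyp : DeltaHyp X δ) : ConvergesToInfinity (p 0) (fun n => p (n + 1)) := by
  have key (m k : ℕ) : (m : ℝ) - |L| ≤ gprod (p 0) (p (m + 1)) (p (m + k + 1)) := by
    have h₁ := hp.le_dist_zero hδ hhyp m
    have h₂ := abs_nonneg L
    rcases k with _ | k
    · simp only [gprod, add_zero, dist_self]
      linarith
    · have h₃ := gprod_add_gprod (p 0) (p (m + 1)) (p (m + k + 2))
      have h₄ := hp.gprod_middle_le hδ hhyp m k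
      have h₅ := le_abs_self L
      rw [show m + (k + 1) + 1 = m + k + 2 by ring]
      linarith
  intro M
  obtain ⟨N, hN⟩ := exists_nat_ge (M + |L|)
  refine ⟨N, fun m n hm hn => ?_⟩
  have hm' : (N : ℝ) ≤ m := by exact_mod_cast hm
  have hn' : (N : ℝ) ≤ n := by exact_mod_cast hn
  rcases le_total m n with h | h
  · obtain ⟨k, rfl⟩ := Nat.exists_eq_add_of_le h
    linarith [key m k]
  · obtain ⟨k, rfl⟩ := Nat.exists_eq_add_of_le h
    rw [gprod_comm]
    linarith [key n k]

end IsLocalQuasiGeodesic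

/-- The prefixes of the infinite word `g h g h ⋯`. -/
def alternatingProd {G : Type*} [Group G] (g h : G) : ℕ → G
  | 0 => 1
  | n + 1 => alternatingProd g h n * if Even n then g else h

theorem isLocalQuasiGeodesic_alternatingProd {X : Type*} [MetricSpace X] {G : Type*} [Group G]
    [MulAction G X] (hiso : ∀ u : G, Isometry (fun y : X => u • y)) {δ L : ℝ} {x : X} {g h : G}
    (hg : L ≤ dist x (g • x)) (hh : L ≤ dist x (h • x))
    (hgh : gprod x (g⁻¹ • x) (h • x) ≤ L / 2 - (2 * δ + 1))
    (hhg : gprod x (h⁻¹ • x) (g • x) ≤ L / 2 - (2 * δ + 1)) :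
    IsLocalQuasiGeodesic δ L (fun n => alternatingProd g h n • x) where
  le_dist n := by
    simp only [alternatingProd, mul_smul]
    rw [(hiso (alternatingProd g h n)).dist_eq x _]
    split_ifs <;> assumption
  gprod_le n := by
    have h₁ : alternatingProd g h n • x =
        alternatingProd g h (n + 1) • (if Even n then g else h)⁻¹ • x := by
      simp only [alternatingProd, mul_smul, smul_inv_smul]
    have h₂ : alternatingProd g h (n + 2) • x =
        alternatingProd g h (n + 1) • (if Even (n + 1) then g else h) • x := by
      rw [← mul_smul]
      rfl
    simp only [h₁, h₂]
    rw [gprod_smul hiso]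
    by_cases hn : Even n
    · simpa [hn, Nat.even_add_one] using hgh
    · simpa [hn, Nat.even_add_one] using hhg

theorem unbounded_orbit_gives_sequence_to_infinity
    {X : Type*} [MetricSpace X] {δ : ℝ} (hδ : 0 ≤ δ)
    (hhyp : DeltaHyp X δ) (hlen : IsLengthSpace X)
    {G : Type*} [Group G] [MulAction G X]
    (hiso : ∀ u : G, Isometry (fun y : X => u • y))
    (x : X) (hub : ¬ Bornology.IsBounded (MulAction.orbit G x)) :
    ∃ g : ℕ → G, ConvergesToInfinity x (fun n => g n • x) := by
  by_cases hex : ∃ g h : G,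
      gprod x (g⁻¹ • x) (h • x) ≤ min (dist x (g • x)) (dist x (h • x)) / 2 - (2 * δ + 1) ∧
      gprod x (h⁻¹ • x) (g • x) ≤ min (dist x (g • x)) (dist x (h • x)) / 2 - (2 * δ + 1)
  · obtain ⟨g, h, hgh, hhg⟩ := hex
    have hc := (isLocalQuasiGeodesic_alternatingProd hiso (min_le_left _ _) (min_le_right _ _)
      hgh hhg).convergesToInfinity hδ hhyp
    simp only [alternatingProd, one_smul] at hc
    exact ⟨_, hc⟩
  · push Not at hex
    have hinv (g : G) : dist x (g • x) / 2 - (2 * δ + 1) < gprod x (g⁻¹ • x) (g • x) := by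
      by_contra! hg
      have := hex g g (by simpa using hg)
      rw [min_self] at this
      linarith
    have key (g h : G) : min (dist x (g • x)) (dist x (h • x)) / 2 - (3 * δ + 1) ≤
        gprod x (g • x) (h • x) := by
      have hg := hinv g
      have hh := hinv h
      have hl := min_le_left (dist x (g • x)) (dist x (h • x))
      have hr := min_le_right (dist x (g • x)) (dist x (h • x))
      rcases le_or_gt (gprod x (g⁻¹ • x) (h • x))
        (min (dist x (g • x)) (dist x (h • x)) / 2 - (2 * δ + 1)) with hc | hc
      · have h₁ := hex g h hc
        have h₂ := hhyp (g • x) (h⁻¹ • x) (h • x) x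
        rw [gprod_comm x (g • x) (h⁻¹ • x)] at h₂
        have := lt_min h₁ (lt_of_le_of_lt (by linarith) hh)
        linarith
      · have h₂ := hhyp (g • x) (g⁻¹ • x) (h • x) x
        rw [gprod_comm x (g • x) (g⁻¹ • x)] at h₂
        have := lt_min (lt_of_le_of_lt (by linarith) hg) hc
        linarith
    have hfar (n : ℕ) : ∃ g : G, (n : ℝ) ≤ dist x (g • x) := by
      by_contra! hn
      refine hub ((Metric.isBounded_closedBall (x := x) (r := n)).subset ?_)
      rintro _ ⟨g, rfl⟩
      rw [Metric.mem_closedBall, dist_comm]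
      exact (hn g).le
    choose g hg using hfar
    refine ⟨g, fun M => ?_⟩
    obtain ⟨N, hN⟩ := exists_nat_ge (2 * (M + (3 * δ + 1)))
    refine ⟨N, fun m n hm hn => ?_⟩
    have hm' : (N : ℝ) ≤ m := by exact_mod_cast hm
    have hn' : (N : ℝ) ≤ n := by exact_mod_cast hn
    have := le_min (hm'.trans (hg m)) (hn'.trans (hg n))
    linarith [key (g m) (g n)]
end

section
/- Let δ ≥ 0, let X be a δ-hyperbolic length space, and let G be a group acting by isometries on X. Let x ∈ X. Suppose there exist sequences (gₙ) and (hₙ) of elements of G such that the sequences (gₙ·x) and (hₙ·x) both converge to infinity and limsup_{n→∞} (gₙ·x, hₙ·x)_x < ∞. Then G contains a loxodromic element, i.e. some g ∈ G with asymptotic translation length [g]^∞ > 0. -/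
/-- In a hyperbolic space, if `(x,z)_t` is small and `(x,y)_t` is large, then `(y,z)_t` is
small. -/
theorem DeltaHyp.gprod_le_of_lt {X : Type*} [MetricSpace X] {δ : ℝ} (h : DeltaHyp X δ)
    {t x y z : X} {C : ℝ} (hC : gprod t x z ≤ C) (hy : C + δ < gprod t x y) :
    gprod t y z ≤ C + δ := by
  have h₁ := h x y z t
  by_contra! h₂
  have := lt_min hy h₂
  linarith

/-- The four-point inequality for distances. -/
theorem DeltaHyp.dist_add_dist_le {X : Type*} [MetricSpace X] {δ : ℝ} (h : DeltaHyp X δ)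
    (x y z t : X) :
    dist t y + dist x z ≤ max (dist t x + dist y z) (dist t z + dist x y) + 2 * δ := by
  have h₁ := h x y z t
  unfold gprod at h₁
  rcases min_choice ((dist t x + dist t y - dist x y) / 2)
    ((dist t y + dist t z - dist y z) / 2) with h₂ | h₂ <;> rw [h₂] at h₁
  · have := le_max_right (dist t x + dist y z) (dist t z + dist x y)
    linarith
  · have := le_max_left (dist t x + dist y z) (dist t z + dist x y)
    linarith

section IsometricAction

variable {X : Type*} [MetricSpace X] {G : Type*} [Group G] [MulAction G X]

theorem dist_mul_smul_smul (hiso : ∀ u : G, Isometry (fun y : X => u • y)) (x : X) (g a b : G) :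
    dist ((g * a) • x) ((g * b) • x) = dist (a • x) (b • x) := by
  simpa only [mul_smul] using (hiso g).dist_eq (a • x) (b • x)

theorem dist_smul_smul_eq (hiso : ∀ u : G, Isometry (fun y : X => u • y)) (x : X) (a b : G) :
    dist (a • x) (b • x) = dist ((a⁻¹ * b) • x) x := by
  have h := dist_mul_smul_smul hiso x a 1 (a⁻¹ * b)
  rw [mul_one, mul_inv_cancel_left, one_smul] at h
  rw [h, dist_comm]

theorem dist_inv_smul (hiso : ∀ u : G, Isometry (fun y : X => u • y)) (x : X) (g : G) :
    dist (g⁻¹ • x) x = dist (g • x) x := by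
  have h := dist_smul_smul_eq hiso x g 1
  rw [one_smul, mul_one] at h
  exact h.symm

theorem gprod_smul_smul (hiso : ∀ u : G, Isometry (fun y : X => u • y)) (x : X) (a b : G) :
    gprod x (a • x) (b • x)
      = (dist (a • x) x + dist (b • x) x - dist ((a⁻¹ * b) • x) x) / 2 := by
  unfold gprod
  rw [dist_smul_smul_eq hiso, dist_comm x, dist_comm x]

/-- If `g²` moves `x` sufficiently further than `g` does, then the displacement of `x` under
the powers of `g` grows at least linearly. -/
theorem DeltaHyp.dist_pow_succ_smul_ge {δ : ℝ} (hδ : 0 ≤ δ) (hhyp : DeltaHyp X δ)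
    (hiso : ∀ u : G, Isometry (fun y : X => u • y)) {x : X} {g : G} {a : ℝ} (ha : 0 < a)
    (hg : dist (g • x) x + 2 * δ + a ≤ dist ((g ^ 2) • x) x) (n : ℕ) :
    dist ((g ^ n) • x) x + a ≤ dist ((g ^ (n + 1)) • x) x := by
  have hstep (k : ℕ) : dist ((g ^ k) • x) ((g ^ (k + 1)) • x) = dist (g • x) x := by
    rw [pow_succ]
    simpa [dist_comm] using dist_mul_smul_smul hiso x (g ^ k) 1 g
  have hstep_two (k : ℕ) :
      dist ((g ^ k) • x) ((g ^ (k + 2)) • x) = dist ((g ^ 2) • x) x := by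
    rw [pow_add]
    simpa [dist_comm] using dist_mul_smul_smul hiso x (g ^ k) 1 (g ^ 2)
  induction n with
  | zero =>
    have h₁ := hstep 1
    have h₂ := dist_triangle ((g ^ 2) • x) (g • x) x
    rw [pow_one, dist_comm] at h₁
    simp only [pow_zero, one_smul, dist_self, zero_add, pow_one]
    norm_num at h₁
    linarith
  | succ n ih =>
    have h := hhyp.dist_add_dist_le ((g ^ n) • x) ((g ^ (n + 1)) • x) ((g ^ (n + 1 + 1)) • x) x
    rw [hstep_two n, hstep n, hstep (n + 1)] at h
    rw [dist_comm x, dist_comm x, dist_comm x] at h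
    rcases max_choice (dist ((g ^ n) • x) x + dist (g • x) x)
      (dist ((g ^ (n + 1 + 1)) • x) x + dist (g • x) x) with h' | h' <;> rw [h'] at h <;>
      linarith

theorem subadditive_dist_pow_smul (hiso : ∀ u : G, Isometry (fun y : X => u • y)) (x : X) (g : G) :
    Subadditive (fun n : ℕ => dist ((g ^ n) • x) x) := by
  intro m n
  have h := dist_mul_smul_smul hiso x (g ^ m) (g ^ n) 1
  rw [mul_one, one_smul, ← pow_add] at h
  linarith [dist_triangle ((g ^ (m + n)) • x) ((g ^ m) • x) x]

/-- An isometry `g` whose square moves `x` sufficiently further than `g` does is loxodromic. -/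
theorem DeltaHyp.exists_tendsto_dist_pow_smul_div {δ : ℝ} (hδ : 0 ≤ δ) (hhyp : DeltaHyp X δ)
    (hiso : ∀ u : G, Isometry (fun y : X => u • y)) {x : X} {g : G} {a : ℝ} (ha : 0 < a)
    (hg : dist (g • x) x + 2 * δ + a ≤ dist ((g ^ 2) • x) x) :
    ∃ ℓ : ℝ, 0 < ℓ ∧
      Filter.Tendsto (fun n : ℕ => dist ((g ^ n) • x) x / n) Filter.atTop (nhds ℓ) := by
  have hlin (n : ℕ) : n * a ≤ dist ((g ^ n) • x) x := by
    induction n with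
    | zero => simp
    | succ n ih =>
      have := hhyp.dist_pow_succ_smul_ge hδ hiso ha hg n
      push_cast
      linarith
  have hsub := subadditive_dist_pow_smul hiso x g
  have hlim := hsub.tendsto_lim ⟨0, by rintro _ ⟨n, rfl⟩; positivity⟩
  refine ⟨hsub.lim, ha.trans_le (ge_of_tendsto hlim ?_), hlim⟩
  filter_upwards [Filter.eventually_gt_atTop 0] with n hn
  rw [le_div_iff₀ (by exact_mod_cast hn), mul_comm]
  exact hlin n

/-- Sequences converging to infinity leave every ball. -/
theorem ConvergesToInfinity.exists_le_dist {x : X} {z : ℕ → X} (h : ConvergesToInfinity x z)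
    (M : ℝ) : ∃ N : ℕ, ∀ n, N ≤ n → M ≤ dist (z n) x := by
  obtain ⟨N, hN⟩ := h M
  refine ⟨N, fun n hn => (hN n n hn hn).trans_eq ?_⟩
  simp [gprod, dist_comm]

end IsometricAction

theorem exists_loxodromic_of_two_sequences_to_infinity
    {X : Type*} [MetricSpace X] {δ : ℝ} (hδ : 0 ≤ δ)
    (hhyp : DeltaHyp X δ) (hlen : IsLengthSpace X)
    {G : Type*} [Group G] [MulAction G X]
    (hiso : ∀ u : G, Isometry (fun y : X => u • y))
    (x : X) (u v : ℕ → G)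
    (hu : ConvergesToInfinity x (fun n => u n • x))
    (hv : ConvergesToInfinity x (fun n => v n • x))
    (hbdd : ∃ C : ℝ, ∃ N : ℕ, ∀ n : ℕ, N ≤ n → gprod x (u n • x) (v n • x) ≤ C) :
    ∃ g : G, ∃ ℓ : ℝ, 0 < ℓ ∧
      Filter.Tendsto (fun n : ℕ => dist ((g ^ n) • x) x / n) Filter.atTop (nhds ℓ) := by
  suffices h : ∃ g : G, dist (g • x) x + 2 * δ + 1 ≤ dist ((g ^ 2) • x) x by
    obtain ⟨g, hg⟩ := h
    exact ⟨g, hhyp.exists_tendsto_dist_pow_smul_div hδ hiso one_pos hg⟩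
  by_contra! hno
  have hback (g : G) : (dist (g • x) x - 2 * δ - 1) / 2 < gprod x (g⁻¹ • x) (g • x) := by
    have := hno g
    rw [gprod_smul_smul hiso, dist_inv_smul hiso, inv_inv, ← pow_two]
    linarith
  obtain ⟨C, N, hC⟩ := hbdd
  obtain ⟨N₁, hN₁⟩ := hu.exists_le_dist (4 * |C| + 20 * δ + 10)
  obtain ⟨N₂, hN₂⟩ := hv.exists_le_dist (4 * |C| + 20 * δ + 10)
  obtain ⟨n, hn, hn₁, hn₂⟩ : ∃ n, N ≤ n ∧ N₁ ≤ n ∧ N₂ ≤ n :=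
    ⟨max N (max N₁ N₂), by simp, by simp, by simp⟩
  specialize hC n hn
  specialize hN₁ n hn₁
  specialize hN₂ n hn₂
  generalize u n = a at *
  generalize v n = b at *
  have hC_abs := le_abs_self C
  have hC_nonneg := abs_nonneg C
  have ha := hback a
  have hb := hback b
  have h₁ : gprod x (a⁻¹ • x) (b • x) ≤ C + δ :=
    hhyp.gprod_le_of_lt hC (by rw [gprod_comm]; linarith)
  have h₂ : gprod x (b⁻¹ • x) (a • x) ≤ C + δ :=
    hhyp.gprod_le_of_lt (gprod_comm x _ _ ▸ hC) (by rw [gprod_comm]; linarith)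
  have hab : dist (a • x) x + dist (b • x) x - 2 * (C + δ) ≤ dist ((a * b) • x) x := by
    rw [gprod_smul_smul hiso, dist_inv_smul hiso, inv_inv] at h₁
    linarith
  have h₃ : gprod x ((a * b) • x) (b⁻¹ • x) ≤ C + δ + δ := by
    refine hhyp.gprod_le_of_lt (gprod_comm x _ _ ▸ h₂) ?_
    rw [gprod_smul_smul hiso, inv_mul_cancel_left]
    linarith
  have h₄ : gprod x ((a * b)⁻¹ • x) ((a * b) • x) ≤ C + δ + δ + δ := by
    refine hhyp.gprod_le_of_lt (gprod_comm x _ _ ▸ h₃) ?_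
    rw [gprod_smul_smul hiso, inv_inv, mul_inv_rev, mul_inv_cancel_left, dist_inv_smul hiso,
      ← mul_inv_rev, dist_inv_smul hiso, dist_inv_smul hiso]
    linarith
  linarith [hback (a * b)]
end

section
/- Let E be a group and let F be a finite normal subgroup of E. Let n be a positive multiple of the exponent of the holomorph Hol(F) = F ⋊ Aut(F). Then for every g ∈ E and every u ∈ F, the identities (ug)ⁿ = gⁿ and u·gⁿ·u⁻¹ = gⁿ hold. -/
/-- In the holomorph of a normal subgroup `F`, the `F`-component of the `k`-th power of
`(u, conjugation by g)` is `(u * g) ^ k * (g ^ k)⁻¹`. -/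
theorem left_holomorph_pow_mul_pow {E : Type*} [Group E] (F : Subgroup E) [F.Normal]
    (g : E) (u : F) (k : ℕ) :
    (((⟨u, MulAut.conjNormal g⟩ : SemidirectProduct F (MulAut F) (MonoidHom.id (MulAut F))) ^ k).left
      : E) * g ^ k = (u * g) ^ k := by
  induction k with
  | zero => simp
  | succ k ih =>
    rw [pow_succ', pow_succ' (u * g : E), ← ih, SemidirectProduct.mul_left, MonoidHom.id_apply,
      Subgroup.coe_mul, MulAut.conjNormal_apply, pow_succ']
    group

theorem pow_eq_of_holomorph_exponent_dvd {E : Type*} [Group E]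
    (F : Subgroup E) (hFn : F.Normal) [Finite F]
    (n : ℕ) (hn : 0 < n)
    (hdvd : Monoid.exponent (SemidirectProduct F (MulAut F) (MonoidHom.id (MulAut F))) ∣ n) :
    ∀ g : E, ∀ u ∈ F, (u * g) ^ n = g ^ n ∧ u * g ^ n * u⁻¹ = g ^ n := by
  intro g u hu
  have hpow := Monoid.exponent_dvd_iff_forall_pow_eq_one.mp hdvd
  constructor
  · rw [← left_holomorph_pow_mul_pow F g ⟨u, hu⟩ n, hpow]
    simp
  · have hconj : MulAut.conjNormal (H := F) (g ^ n) = 1 := by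
      rw [map_pow]
      apply SemidirectProduct.inr_injective (φ := MonoidHom.id (MulAut F))
      rw [map_pow, map_one, hpow]
    have hcomm : g ^ n * u * (g ^ n)⁻¹ = u := by
      rw [← MulAut.conjNormal_apply (g ^ n) (⟨u, hu⟩ : F), hconj, MulAut.one_apply]
    rw [mul_inv_eq_iff_eq_mul] at hcomm ⊢
    exact hcomm.symm
end

section
/- Fix ρ > 0 and define μ : [0,∞) → [0,∞) by μ(t) = arcosh( cosh²(ρ) − sinh²(ρ)·cos( min{π, t/sinh(ρ)} ) ), so that cosh(μ(t)) = cosh²(ρ) − sinh²(ρ)·cos(min{π, t/sinh(ρ)}). Then μ is continuous, concave and non-decreasing; moreover: (1) for every t ≥ 0, t − (1/24)·(1 + 1/sinh²(ρ))·t³ ≤ μ(t) ≤ t; and (2) for every t ∈ [0, π·sinh(ρ)], t ≤ π·sinh(μ(t)/2). -/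
open Real

theorem concaveOn_arsinh : ConcaveOn ℝ (Set.Ici 0) arsinh := by
  refine AntitoneOn.concaveOn_of_deriv (convex_Ici 0) continuous_arsinh.continuousOn
    differentiable_arsinh.differentiableOn ?_
  intro x hx y _ hxy
  rw [interior_Ici, Set.mem_Ioi] at hx
  rw [(hasDerivAt_arsinh x).deriv, (hasDerivAt_arsinh y).deriv]
  gcongr

theorem sub_cube_le_arsinh {x : ℝ} (hx : 0 ≤ x) : x - x ^ 3 / 6 ≤ arsinh x := by
  have hd (y : ℝ) : HasDerivAt (fun z : ℝ => arsinh z - (z - z ^ 3 / 6))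
      ((√(1 + y ^ 2))⁻¹ - (1 - y ^ 2 / 2)) y := by
    refine ((hasDerivAt_arsinh y).sub
      ((hasDerivAt_id y).sub ((hasDerivAt_pow 3 y).div_const 6))).congr_deriv ?_
    norm_num
    ring
  have hmono : Monotone (fun z : ℝ => arsinh z - (z - z ^ 3 / 6)) := by
    refine monotone_of_deriv_nonneg (fun y => (hd y).differentiableAt) fun y => ?_
    rw [(hd y).deriv, sub_nonneg]
    have hsqrt : √(1 + y ^ 2) ≤ 1 + y ^ 2 / 2 := by
      rw [Real.sqrt_le_left (by positivity)]
      nlinarith [sq_nonneg (y ^ 2)]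
    have hpos : 0 < √(1 + y ^ 2) := Real.sqrt_pos.2 (by positivity)
    calc 1 - y ^ 2 / 2 ≤ (1 + y ^ 2 / 2)⁻¹ := by
          rw [← one_div, le_div_iff₀ (by positivity)]
          nlinarith [sq_nonneg (y ^ 2)]
      _ ≤ (√(1 + y ^ 2))⁻¹ := by gcongr
  have h := hmono hx
  norm_num at h
  linarith

theorem arsinh_le_self {x : ℝ} (hx : 0 ≤ x) : arsinh x ≤ x := by
  rw [← sinh_le_sinh, sinh_arsinh]
  exact self_le_sinh_iff.2 hx

theorem half_min_pi_mem_Icc {x : ℝ} (hx : 0 ≤ x) :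
    min π x / 2 ∈ Set.Icc 0 (π / 2) :=
  ⟨div_nonneg (le_min pi_pos.le hx) zero_le_two, by gcongr; exact min_le_left _ _⟩

theorem monotoneOn_sin_half_min_pi {s : ℝ} (hs : 0 < s) :
    MonotoneOn (fun t => sin (min π (t / s) / 2)) (Set.Ici 0) := by
  intro t ht u hu htu
  have ht' := half_min_pi_mem_Icc (div_nonneg ht hs.le)
  have hu' := half_min_pi_mem_Icc (div_nonneg hu hs.le)
  refine sin_le_sin_of_le_of_le_pi_div_two (by linarith [ht'.1, pi_pos]) hu'.2 ?_
  gcongr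

theorem concaveOn_sin_half_min_pi {s : ℝ} (hs : 0 < s) :
    ConcaveOn ℝ (Set.Ici 0) (fun t => sin (min π (t / s) / 2)) := by
  have hmaps : (fun t => min π (t / s) / 2) '' Set.Ici 0 ⊆ Set.Icc 0 (π / 2) := by
    rintro _ ⟨t, ht, rfl⟩
    exact half_min_pi_mem_Icc (div_nonneg ht hs.le)
  have hconc : ConcaveOn ℝ (Set.Ici 0) (fun t => min π (t / s) / 2) := by
    refine ⟨convex_Ici 0, fun x _ y _ a b ha hb hab => ?_⟩
    simp only [smul_eq_mul]
    have h1 : a * min π (x / s) + b * min π (y / s) ≤ min π ((a * x + b * y) / s) := by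
      refine le_min ?_ ?_
      · calc a * min π (x / s) + b * min π (y / s) ≤ a * π + b * π := by
              gcongr <;> exact min_le_left _ _
          _ = π := by rw [← add_mul, hab, one_mul]
      · calc a * min π (x / s) + b * min π (y / s) ≤ a * (x / s) + b * (y / s) := by
              gcongr <;> exact min_le_right _ _
          _ = (a * x + b * y) / s := by ring
    linarith
  have himage : Convex ℝ ((fun t => min π (t / s) / 2) '' Set.Ici 0) := by
    refine Set.OrdConnected.convex (IsPreconnected.ordConnected ?_)
    exact isPreconnected_Ici.image _ (by fun_prop)
  refine ConcaveOn.comp (g := sin) ?_ hconc ?_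
  · exact strictConcaveOn_sin_Icc.concaveOn.subset
      (hmaps.trans (Set.Icc_subset_Icc_right (by linarith [pi_pos]))) himage
  · refine (strictMonoOn_sin.monotoneOn).mono
      (hmaps.trans (Set.Icc_subset_Icc_left (by linarith [pi_pos])))

theorem sinh_half_eq_of_cosh_eq {m ρ θ : ℝ} (hρ : 0 ≤ ρ) (hm : 0 ≤ m) (hθ : 0 ≤ sin (θ / 2))
    (h : cosh m = cosh ρ ^ 2 - sinh ρ ^ 2 * cos θ) : sinh (m / 2) = sinh ρ * sin (θ / 2) := by
  have hm' : cosh m = 1 + 2 * sinh (m / 2) ^ 2 := by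
    rw [← mul_div_cancel₀ m (two_ne_zero' ℝ), cosh_two_mul, cosh_sq]
    ring_nf
  have hcos : cos θ = 1 - 2 * sin (θ / 2) ^ 2 := by
    have h2 := cos_two_mul' (θ / 2)
    rw [mul_div_cancel₀ θ (two_ne_zero' ℝ)] at h2
    linarith [sin_sq_add_cos_sq (θ / 2)]
  have hsq : sinh (m / 2) ^ 2 = (sinh ρ * sin (θ / 2)) ^ 2 := by
    rw [hm', hcos, cosh_sq] at h
    linarith
  exact (pow_left_inj₀ (sinh_nonneg_iff.2 (by positivity))
    (mul_nonneg (sinh_nonneg_iff.2 hρ) hθ) two_ne_zero).1 hsq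

theorem cone_comparison_map_properties (ρ : ℝ) (hρ : 0 < ρ) (μ : ℝ → ℝ)
    (hμnonneg : ∀ t : ℝ, 0 ≤ t → 0 ≤ μ t)
    (hμ : ∀ t : ℝ, 0 ≤ t → Real.cosh (μ t) =
      Real.cosh ρ ^ 2 - Real.sinh ρ ^ 2 * Real.cos (min π (t / Real.sinh ρ))) :
    ContinuousOn μ (Set.Ici 0) ∧
    ConcaveOn ℝ (Set.Ici 0) μ ∧
    MonotoneOn μ (Set.Ici 0) ∧
    (∀ t : ℝ, 0 ≤ t →
      t - (1 / 24) * (1 + 1 / Real.sinh ρ ^ 2) * t ^ 3 ≤ μ t ∧ μ t ≤ t) ∧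
    (∀ t : ℝ, 0 ≤ t → t ≤ π * Real.sinh ρ → t ≤ π * Real.sinh (μ t / 2)) := by
  have hs : 0 < sinh ρ := sinh_pos_iff.2 hρ
  set s := sinh ρ with hs_def
  have hmem {t : ℝ} (ht : 0 ≤ t) := half_min_pi_mem_Icc (div_nonneg ht hs.le)
  have hsin {t : ℝ} (ht : 0 ≤ t) : 0 ≤ sin (min π (t / s) / 2) :=
    sin_nonneg_of_nonneg_of_le_pi (hmem ht).1 (by linarith [(hmem ht).2, pi_pos])
  have hsinh {t : ℝ} (ht : 0 ≤ t) : sinh (μ t / 2) = s * sin (min π (t / s) / 2) :=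
    sinh_half_eq_of_cosh_eq hρ.le (hμnonneg t ht) (hsin ht) (hμ t ht)
  have heq : Set.EqOn (fun t => 2 * arsinh (s * sin (min π (t / s) / 2))) μ (Set.Ici 0) := by
    intro t ht
    simp only [← hsinh ht, arsinh_sinh]
    ring
  have hcont : Continuous (fun t => s * sin (min π (t / s) / 2)) := by fun_prop
  have hmono : MonotoneOn (fun t => s * sin (min π (t / s) / 2)) (Set.Ici 0) :=
    fun _ ht _ hu htu =>
      mul_le_mul_of_nonneg_left (monotoneOn_sin_half_min_pi hs ht hu htu) hs.le
  refine ⟨?_, ?_, ?_, fun t ht => ?_, fun t ht hts => ?_⟩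
  · exact (continuous_const.mul hcont.arsinh).continuousOn.congr heq.symm
  · refine ConcaveOn.congr ?_ heq
    refine ConcaveOn.smul (c := (2 : ℝ)) zero_le_two ?_
    refine ConcaveOn.comp (g := arsinh) ?_ ((concaveOn_sin_half_min_pi hs).smul hs.le)
      (arsinh_strictMono.monotone.monotoneOn _)
    refine concaveOn_arsinh.subset ?_ ?_
    · rintro _ ⟨t, ht, rfl⟩
      exact mul_nonneg hs.le (hsin ht)
    · exact Set.OrdConnected.convex
        (isPreconnected_Ici.image _ hcont.continuousOn).ordConnected
  · refine MonotoneOn.congr ?_ heq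
    intro t ht u hu htu
    have h := arsinh_le_arsinh.2 (hmono ht hu htu)
    simp only at h ⊢
    linarith
  · rw [← heq ht]
    simp only
    set x := s * sin (min π (t / s) / 2) with hx
    have hx0 : 0 ≤ x := mul_nonneg hs.le (hsin ht)
    have hx_le : x ≤ t / 2 := by
      calc x ≤ s * (t / s / 2) := by
            rw [hx]
            gcongr
            refine (sin_le (hmem ht).1).trans ?_
            gcongr
            exact min_le_right _ _
        _ = t / 2 := by field_simp
    have hle_x : t / 2 - t ^ 3 / (48 * s ^ 2) ≤ x := by
      have h : t / s / 2 - (t / s / 2) ^ 3 / 6 ≤ sin (min π (t / s) / 2) := by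
        refine (sin_ge_sub_cube (by positivity)).trans ?_
        rcases le_total π (t / s) with hπ | hπ
        · rw [min_eq_left hπ, sin_pi_div_two]
          exact sin_le_one _
        · rw [min_eq_right hπ]
      calc t / 2 - t ^ 3 / (48 * s ^ 2) = s * (t / s / 2 - (t / s / 2) ^ 3 / 6) := by
            field_simp
            ring
        _ ≤ x := by rw [hx]; gcongr
    have hcube : x ^ 3 ≤ (t / 2) ^ 3 := by gcongr
    constructor
    · have h1 : t - 1 / 24 * (1 + 1 / s ^ 2) * t ^ 3 =
          2 * (t / 2 - t ^ 3 / (48 * s ^ 2)) - (t / 2) ^ 3 / 3 := by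
        field_simp
        ring
      linarith [sub_cube_le_arsinh hx0]
    · linarith [arsinh_le_self hx0]
  · have hmin : min π (t / s) = t / s := min_eq_right ((div_le_iff₀ hs).2 hts)
    have hjordan := mul_le_sin (hmem ht).1 (hmem ht).2
    rw [hsinh ht]
    calc t = π * (s * (2 / π * (min π (t / s) / 2))) := by
          rw [hmin]
          field_simp
      _ ≤ π * (s * sin (min π (t / s) / 2)) := by gcongr
end

section
/- For all real numbers ρ > 0, r with 0 ≤ r ≤ ρ, and a ≥ 0, one has arcosh( 1 + sinh²(r)·(1 − cos( min{π, a/sinh(ρ)} )) ) ≤ (sinh(r)/sinh(ρ))·a. -/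
/-- The inverse of `cosh` restricted to `[1, ∞)`:
`arcosh x = log (x + √(x² - 1))`. -/
noncomputable def arcosh (x : ℝ) : ℝ := Real.log (x + Real.sqrt (x ^ 2 - 1))

theorem Real.one_add_sq_div_two_le_cosh {x : ℝ} (hx : 0 ≤ x) : 1 + x ^ 2 / 2 ≤ Real.cosh x := by
  have h_sinh : x / 2 ≤ Real.sinh (x / 2) := Real.self_le_sinh_iff.2 (by positivity)
  have h_sq : (x / 2) ^ 2 ≤ Real.sinh (x / 2) ^ 2 := by gcongr
  have h_double : Real.cosh x = Real.cosh (x / 2) ^ 2 + Real.sinh (x / 2) ^ 2 := by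
    rw [← Real.cosh_two_mul, mul_div_cancel₀ x two_ne_zero]
  have := Real.cosh_sq (x / 2)
  linarith

theorem cone_lipschitz_inequality (ρ r a : ℝ) (hρ : 0 < ρ) (hr0 : 0 ≤ r)
    (hrρ : r ≤ ρ) (ha : 0 ≤ a) :
    arcosh (1 + Real.sinh r ^ 2 *
        (1 - Real.cos (min Real.pi (a / Real.sinh ρ)))) ≤
      (Real.sinh r / Real.sinh ρ) * a := by
  have hsρ : 0 < Real.sinh ρ := Real.sinh_pos_iff.2 hρ
  have hsr : 0 ≤ Real.sinh r := Real.sinh_nonneg_iff.2 hr0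
  set t := a / Real.sinh ρ with ht
  have ht0 : 0 ≤ t := by positivity
  have h_eq : Real.sinh r / Real.sinh ρ * a = Real.sinh r * t := by rw [ht]; ring
  have h_cos : 1 - Real.cos (min Real.pi t) ≤ t ^ 2 / 2 := by
    have h_min : min Real.pi t ^ 2 ≤ t ^ 2 :=
      pow_le_pow_left₀ (le_min Real.pi_pos.le ht0) (min_le_right _ _) 2
    have := Real.one_sub_sq_div_two_le_cos (x := min Real.pi t)
    linarith
  have h_pos : 0 ≤ Real.sinh r ^ 2 * (1 - Real.cos (min Real.pi t)) :=
    mul_nonneg (sq_nonneg _) (sub_nonneg.2 (Real.cos_le_one _))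
  have h_nonneg : 0 ≤ Real.sinh r * t := mul_nonneg hsr ht0
  rw [h_eq, ← Real.arcosh_cosh h_nonneg]
  refine (Real.arcosh_le_arcosh (add_pos_of_pos_of_nonneg one_pos h_pos) (Real.cosh_pos _)).2 ?_
  calc 1 + Real.sinh r ^ 2 * (1 - Real.cos (min Real.pi t))
      ≤ 1 + Real.sinh r ^ 2 * (t ^ 2 / 2) := by gcongr
    _ = 1 + (Real.sinh r * t) ^ 2 / 2 := by ring
    _ ≤ Real.cosh (Real.sinh r * t) := Real.one_add_sq_div_two_le_cosh h_nonneg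
end

section
/- Let X be a metric space and let G be a group acting by isometries on X. Let l ≥ 0, d ≥ 0 and let N be a natural number such that for all x, x' ∈ X with d(x,x') ≥ d, the set { u ∈ G : d(u·x, x) ≤ l and d(u·x', x') ≤ l } has at most N elements. Let h ∈ G with asymptotic translation length [h]^∞ > 0, let M be a natural number with M·[h]^∞ ≥ d, and let m be an integer with m ≥ N + M. If g ∈ G and x ∈ X satisfy d( h⁻ʲ g hʲ · x , x ) ≤ l for every integer j with 0 ≤ j ≤ m, then there exists an integer i with 1 ≤ i ≤ N such that h⁻ⁱ g hⁱ = g; in particular g commutes with hⁱ. -/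
/-- Along the orbit of an isometry, displacement grows at most linearly. -/
theorem dist_pow_smul_le {X : Type*} [PseudoMetricSpace X] {G : Type*} [Group G] [MulAction G X]
    {a : G} (ha : Isometry (fun y : X => a • y)) (x : X) (k : ℕ) :
    dist ((a ^ k) • x) x ≤ k * dist (a • x) x := by
  induction k with
  | zero => simp
  | succ k ih =>
    have hstep : dist ((a ^ (k + 1)) • x) (a • x) = dist ((a ^ k) • x) x := by
      rw [pow_succ', mul_smul]
      exact ha.dist_eq _ _
    have htri := dist_triangle ((a ^ (k + 1)) • x) (a • x) x
    push_cast
    linarith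

/-- The asymptotic translation length bounds the displacement of every power from below. -/
theorem mul_le_dist_pow_smul_of_tendsto {X : Type*} [PseudoMetricSpace X] {G : Type*} [Group G]
    [MulAction G X] (hiso : ∀ u : G, Isometry (fun y : X => u • y)) {h : G} {x : X} {ℓ : ℝ}
    (hlim : Filter.Tendsto (fun n : ℕ => dist ((h ^ n) • x) x / n) Filter.atTop (nhds ℓ))
    (M : ℕ) : M * ℓ ≤ dist ((h ^ M) • x) x := by
  rcases Nat.eq_zero_or_pos M with rfl | hM
  · simp
  have hM' : (0 : ℝ) < M := by exact_mod_cast hM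
  have hsub := hlim.comp (Filter.tendsto_id.const_mul_atTop' hM)
  have hle : ℓ ≤ dist ((h ^ M) • x) x / M := by
    refine le_of_tendsto hsub ?_
    filter_upwards [Filter.eventually_gt_atTop 0] with k hk
    have hk' : (0 : ℝ) < k := by exact_mod_cast hk
    have hbound := dist_pow_smul_le (hiso (h ^ M)) x k
    rw [← pow_mul] at hbound
    simp only [Function.comp_apply, id_eq, Nat.cast_mul]
    rw [div_le_div_iff₀ (by positivity) hM']
    nlinarith
  rw [le_div_iff₀ hM'] at hle
  linarith

theorem conjugates_commute_of_acylindrical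
    {X : Type*} [MetricSpace X] {G : Type*} [Group G] [MulAction G X]
    (hiso : ∀ u : G, Isometry (fun y : X => u • y))
    (l d : ℝ) (hl : 0 ≤ l) (hd : 0 ≤ d) (N : ℕ)
    (hacyl : ∀ x x' : X, d ≤ dist x x' →
      ∃ t : Finset G, (∀ u : G, dist (u • x) x ≤ l → dist (u • x') x' ≤ l → u ∈ t) ∧
        t.card ≤ N)
    (h : G) (ℓ : ℝ) (hℓ : 0 < ℓ)
    (M : ℕ) (hM : d ≤ (M : ℝ) * ℓ) (m : ℕ) (hm : N + M ≤ m)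
    (g : G) (x : X)
    (hlim : Filter.Tendsto (fun n : ℕ => dist ((h ^ n) • x) x / n) Filter.atTop (nhds ℓ))
    (hgx : ∀ j : ℕ, j ≤ m → dist (((h ^ j)⁻¹ * g * h ^ j) • x) x ≤ l) :
    ∃ i : ℕ, 1 ≤ i ∧ i ≤ N ∧ (h ^ i)⁻¹ * g * h ^ i = g ∧ Commute g (h ^ i) := by
  have hfar : d ≤ dist x ((h ^ M) • x) := by
    rw [dist_comm]
    exact hM.trans (mul_le_dist_pow_smul_of_tendsto hiso hlim M)
  obtain ⟨t, ht, hcard⟩ := hacyl x ((h ^ M) • x) hfar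
  have hmaps : ∀ j ∈ Finset.range (N + 1), (h ^ j)⁻¹ * g * h ^ j ∈ t := by
    intro j hj
    have hjN : j ≤ N := Nat.lt_succ_iff.mp (Finset.mem_range.mp hj)
    refine ht _ (hgx j (by omega)) ?_
    have hconj : ((h ^ j)⁻¹ * g * h ^ j) • (h ^ M) • x =
        (h ^ M) • ((h ^ (j + M))⁻¹ * g * h ^ (j + M)) • x := by
      simp only [← mul_smul, pow_add]
      congr 1
      group
    rw [hconj, (hiso (h ^ M)).dist_eq]
    exact hgx (j + M) (by omega)
  obtain ⟨a, ha, b, hb, hab, heq⟩ := Finset.exists_ne_map_eq_of_card_lt_of_maps_to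
    (by rw [Finset.card_range]; omega) hmaps
  wlog hlt : a < b generalizing a b
  · exact this b hb a ha hab.symm heq.symm (by omega)
  rw [Finset.mem_range] at hb
  obtain ⟨i, rfl⟩ := Nat.exists_eq_add_of_lt hlt
  have hfix : (h ^ (i + 1))⁻¹ * g * h ^ (i + 1) = g := by
    have hshift : (h ^ (a + i + 1))⁻¹ * g * h ^ (a + i + 1) =
        (h ^ a)⁻¹ * ((h ^ (i + 1))⁻¹ * g * h ^ (i + 1)) * h ^ a := by
      rw [show a + i + 1 = (i + 1) + a by omega, pow_add h (i + 1) a]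
      group
    rw [hshift] at heq
    exact (mul_left_cancel (mul_right_cancel heq)).symm
  refine ⟨i + 1, by omega, by omega, hfix, ?_⟩
  rw [mul_assoc, inv_mul_eq_iff_eq_mul] at hfix
  exact hfix
end
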